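/- Fix ℓ ∈ ℕ and pairwise distinct real numbers μ₁, …, μ_ℓ, each lying in the open interval (0, 1). Then there exists an open dense subset U ⊆ ℝ² such that for every (z, v) ∈ U the ℓ + 3 polynomials P_{μ₁}(z, v), …, P_{μ_ℓ}(z, v), P₀♯(z, v), P₁♯(z, v), P_{𝔫₃}(z, v) in ℝ[λ] are pairwise coprime. -/

import Mathlib

/-- The factor `P_μ(z, v)` of the minimal polynomial contributed by an eigenvalue branch. -/
noncomputable def Pmu (μ zz vv : ℝ) : Polynomial ℝ :=
  Polynomial.X ^ 6 + Polynomial.C (27/2 * zz^2 + 3/2 * vv^2) * Polynomial.X ^ 4 +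
    Polynomial.C (729/16 * zz^4 + 81/8 * zz^2 * vv^2 + 9/16 * vv^4) * Polynomial.X ^ 2 +
    Polynomial.C (729/16 * zz^6 + 243/16 * zz^4 * vv^2
      + (27/16 - 243/64 * μ) * zz^2 * vv^4 + 1/16 * vv^6)

/-- The factor `P₀♯(z, v)`. -/
noncomputable def P0sharp (zz vv : ℝ) : Polynomial ℝ :=
  Polynomial.X ^ 4 + Polynomial.C (45/4 * zz^2 + 5/4 * vv^2) * Polynomial.X ^ 2 +
    Polynomial.C (81/4 * zz^4 + 9/2 * zz^2 * vv^2 + 1/4 * vv^4)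

/-- The factor `P₁♯(z, v)`. -/
noncomputable def P1sharp (zz vv : ℝ) : Polynomial ℝ :=
  Polynomial.X ^ 2 + Polynomial.C (9/4 * zz^2 + vv^2)

/-- The factor `P_{𝔫₃}(z, v)`. -/
noncomputable def Pn3 (zz vv : ℝ) : Polynomial ℝ :=
  Polynomial.X ^ 3 + Polynomial.C (zz^2 + vv^2) * Polynomial.X

open Polynomial in
/-- A polynomial with nonzero constant remainder modulo `f` is coprime to `f`. -/
theorem isCoprime_of_eq_mul_add_C {p q f : ℝ[X]} {r : ℝ} (h : p = q * f + C r) (hr : r ≠ 0) :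
    IsCoprime p f := by
  refine ⟨C r⁻¹, -C r⁻¹ * q, ?_⟩
  have hC : C r⁻¹ * C r = (1 : ℝ[X]) := by rw [← C_mul, inv_mul_cancel₀ hr, C_1]
  rw [h]
  linear_combination hC

open Polynomial in
theorem isCoprime_X_sq_add_C {s t : ℝ} (h : s ≠ t) :
    IsCoprime (X ^ 2 + C s : ℝ[X]) (X ^ 2 + C t) :=
  isCoprime_of_eq_mul_add_C (q := 1) (r := s - t) (by rw [C_sub]; ring) (sub_ne_zero.2 h)

open Polynomial in
theorem isCoprime_X_sq_add_C_X {s : ℝ} (h : s ≠ 0) : IsCoprime (X ^ 2 + C s : ℝ[X]) X :=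
  isCoprime_of_eq_mul_add_C (q := X) (r := s) (by ring) h

open Polynomial in
theorem Pn3_eq_mul (z v : ℝ) : Pn3 z v = X * (X ^ 2 + C (z ^ 2 + v ^ 2)) := by
  rw [Pn3]; ring

open Polynomial in
theorem P0sharp_eq_mul (z v : ℝ) :
    P0sharp z v = (X ^ 2 + C (9 * z ^ 2 + v ^ 2)) * (X ^ 2 + C ((9 * z ^ 2 + v ^ 2) / 4)) := by
  rw [P0sharp,
    show 45 / 4 * z ^ 2 + 5 / 4 * v ^ 2 = (9 * z ^ 2 + v ^ 2) + (9 * z ^ 2 + v ^ 2) / 4 by ring,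
    show 81 / 4 * z ^ 4 + 9 / 2 * z ^ 2 * v ^ 2 + 1 / 4 * v ^ 4
      = (9 * z ^ 2 + v ^ 2) * ((9 * z ^ 2 + v ^ 2) / 4) by ring, C_add, C_mul]
  ring

/-- The value of `P_μ(z, v)` at `λ² = -s`. -/
theorem isCoprime_Pmu_X_sq_add_C {μ z v s : ℝ}
    (h : (9 * z ^ 2 + v ^ 2 - s) * ((9 * z ^ 2 + v ^ 2) / 4 - s) ^ 2
      - 243 / 64 * μ * z ^ 2 * v ^ 4 ≠ 0) :
    IsCoprime (Pmu μ z v) (Polynomial.X ^ 2 + Polynomial.C s) := by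
  have division (a b d : ℝ) :
      (.X ^ 6 + .C a * .X ^ 4 + .C b * .X ^ 2 + .C d : Polynomial ℝ) =
        (.X ^ 4 + .C (a - s) * .X ^ 2 + .C (b - s * (a - s))) * (.X ^ 2 + .C s)
          + .C (d - s * (b - s * (a - s))) := by
    simp only [Polynomial.C_sub, Polynomial.C_mul]
    ring
  refine isCoprime_of_eq_mul_add_C (division _ _ _) ?_
  convert h using 1
  ring

theorem isCoprime_Pmu_X {μ z v : ℝ} (hμ : μ < 1) (hz : z ≠ 0) (hv : v ≠ 0) :
    IsCoprime (Pmu μ z v) Polynomial.X := by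
  refine isCoprime_of_eq_mul_add_C
    (q := .X ^ 5 + .C (27 / 2 * z ^ 2 + 3 / 2 * v ^ 2) * .X ^ 3 +
      .C (729 / 16 * z ^ 4 + 81 / 8 * z ^ 2 * v ^ 2 + 9 / 16 * v ^ 4) * .X)
    (r := 729 / 16 * z ^ 6 + 243 / 16 * z ^ 4 * v ^ 2
      + (27 / 16 - 243 / 64 * μ) * z ^ 2 * v ^ 4 + 1 / 16 * v ^ 6)
    (by rw [Pmu]; ring) (ne_of_gt ?_)
  have hμ' : 0 < 1 - μ := sub_pos.2 hμ
  have : 0 < 243 / 64 * (1 - μ) * z ^ 2 * v ^ 4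
      + (v ^ 2 - 18 * z ^ 2) ^ 2 * (4 * v ^ 2 + 9 * z ^ 2) / 64 := by positivity
  linear_combination this

theorem isCoprime_Pmu_Pmu {μ ν z v : ℝ} (h : μ ≠ ν) (hz : z ≠ 0) (hv : v ≠ 0) :
    IsCoprime (Pmu μ z v) (Pmu ν z v) := by
  refine isCoprime_of_eq_mul_add_C (q := 1) (r := 243 / 64 * (ν - μ) * z ^ 2 * v ^ 4) ?_ ?_
  · rw [Pmu, Pmu, one_mul, add_assoc _ (Polynomial.C _) (Polynomial.C _), ← Polynomial.C_add]
    congr 2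
    ring
  · have := sub_ne_zero.2 h.symm
    positivity

theorem isCoprime_Pmu_P0sharp {μ z v : ℝ} (hμ : μ ≠ 0) (hz : z ≠ 0) (hv : v ≠ 0) :
    IsCoprime (Pmu μ z v) (P0sharp z v) := by
  have h : 243 / 64 * μ * z ^ 2 * v ^ 4 ≠ 0 := by positivity
  rw [P0sharp_eq_mul]
  exact .mul_right (isCoprime_Pmu_X_sq_add_C (by simpa using h))
    (isCoprime_Pmu_X_sq_add_C (by simpa using h))

theorem isCoprime_Pmu_P1sharp {μ z v : ℝ} (hμ : μ ≠ 1) (hz : z ≠ 0) (hv : v ≠ 0) :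
    IsCoprime (Pmu μ z v) (P1sharp z v) := by
  apply isCoprime_Pmu_X_sq_add_C
  have hμ' : 1 - μ ≠ 0 := sub_ne_zero.2 hμ.symm
  have : 243 / 64 * (1 - μ) * z ^ 2 * v ^ 4 ≠ 0 := by positivity
  convert this using 1
  ring

theorem isCoprime_Pmu_Pn3 {μ z v : ℝ} (hμ : μ < 1) (hz : z ≠ 0) (hv : v ≠ 0)
    (h : 32 * (5 * z ^ 2 - 3 * v ^ 2) ^ 2 - 243 * μ * v ^ 4 ≠ 0) :
    IsCoprime (Pmu μ z v) (Pn3 z v) := by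
  rw [Pn3_eq_mul]
  refine .mul_right (isCoprime_Pmu_X hμ hz hv) (isCoprime_Pmu_X_sq_add_C ?_)
  have : z ^ 2 / 64 * (32 * (5 * z ^ 2 - 3 * v ^ 2) ^ 2 - 243 * μ * v ^ 4) ≠ 0 :=
    mul_ne_zero (by positivity) h
  convert this using 1
  ring

theorem isCoprime_P0sharp_P1sharp {z v : ℝ} (hz : z ≠ 0) (hv : v ≠ 0) :
    IsCoprime (P0sharp z v) (P1sharp z v) := by
  have hz' : 0 < z ^ 2 := by positivity
  have hv' : 0 < v ^ 2 := by positivity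
  rw [P0sharp_eq_mul]
  exact .mul_left (isCoprime_X_sq_add_C (by linarith)) (isCoprime_X_sq_add_C (by linarith))

theorem isCoprime_P0sharp_Pn3 {z v : ℝ} (hz : z ≠ 0) (h : 5 * z ^ 2 - 3 * v ^ 2 ≠ 0) :
    IsCoprime (P0sharp z v) (Pn3 z v) := by
  have hz' : 0 < z ^ 2 := by positivity
  rw [P0sharp_eq_mul, Pn3_eq_mul]
  refine .mul_left (.mul_right (isCoprime_X_sq_add_C_X (by positivity)) ?_)
    (.mul_right (isCoprime_X_sq_add_C_X (by positivity)) ?_)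
  · exact isCoprime_X_sq_add_C (by linarith)
  · exact isCoprime_X_sq_add_C fun h' => h (by linear_combination 4 * h')

theorem isCoprime_P1sharp_Pn3 {z v : ℝ} (hz : z ≠ 0) :
    IsCoprime (P1sharp z v) (Pn3 z v) := by
  have hz' : 0 < z ^ 2 := by positivity
  rw [Pn3_eq_mul]
  exact .mul_right (isCoprime_X_sq_add_C_X (by positivity)) (isCoprime_X_sq_add_C (by linarith))

/-- The parameters `(z, v)` at which none of the resultants vanishes. -/
def coprimeLocus {ι : Type*} (μ : ι → ℝ) : Set (ℝ × ℝ) :=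
  {p | p.1 ≠ 0 ∧ p.2 ≠ 0 ∧ 5 * p.1 ^ 2 - 3 * p.2 ^ 2 ≠ 0 ∧
    ∀ i, 32 * (5 * p.1 ^ 2 - 3 * p.2 ^ 2) ^ 2 - 243 * μ i * p.2 ^ 4 ≠ 0}

theorem isOpen_coprimeLocus {ι : Type*} [Finite ι] (μ : ι → ℝ) : IsOpen (coprimeLocus μ) := by
  simp only [coprimeLocus, Set.ofPred_and, Set.ofPred_forall]
  refine .inter ?_ (.inter ?_ (.inter ?_ (isOpen_iInter_of_finite fun i => ?_))) <;>
    exact isOpen_ne_fun (by fun_prop) (by fun_prop)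

open Polynomial in
theorem dense_coprimeLocus {ι : Type*} [Fintype ι] {μ : ι → ℝ} (hμ : ∀ i, μ i < 1) :
    Dense (coprimeLocus μ) := by
  have fiber (v : ℝ) (hv : v ≠ 0) : Dense {z : ℝ | (z, v) ∈ coprimeLocus μ} := by
    let f : ℝ[X] := 5 * X ^ 2 - C (3 * v ^ 2)
    let g (i : ι) : ℝ[X] := 32 * f ^ 2 - C (243 * μ i * v ^ 4)
    have hf : f ≠ 0 := by
      intro h
      simpa [f, hv] using congrArg (eval 0) h
    have hg (i : ι) : g i ≠ 0 := by
      intro h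
      have h0 : 32 * (3 * v ^ 2) ^ 2 - 243 * μ i * v ^ 4 = 0 := by
        simpa [f, g] using congrArg (eval 0) h
      have hv' : 0 < v ^ 4 := by positivity
      nlinarith [mul_pos (sub_pos.2 (hμ i)) hv']
    have hne : X * f * ∏ i, g i ≠ 0 :=
      mul_ne_zero (mul_ne_zero X_ne_zero hf) (Finset.prod_ne_zero_iff.2 fun i _ => hg i)
    refine (dense_univ.sdiff_finite (finite_setOfPred_isRoot hne)).mono fun z hz => ?_
    simpa [coprimeLocus, f, g, eval_prod, Finset.prod_eq_zero_iff, hv, and_assoc] using hz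
  rw [dense_iff_inter_open]
  rintro W hW ⟨⟨z, v⟩, hzv⟩
  obtain ⟨A, B, hA, hB, hzA, hvB, hAB⟩ := isOpen_prod_iff.1 hW z v hzv
  obtain ⟨v', hv'B, hv'⟩ := (dense_compl_singleton (0 : ℝ)).inter_open_nonempty B hB ⟨v, hvB⟩
  obtain ⟨z', hz'A, hz'⟩ := (fiber v' hv').inter_open_nonempty A hA ⟨z, hzA⟩
  exact ⟨(z', v'), hAB ⟨hz'A, hv'B⟩, hz'⟩

/-- For pairwise distinct `μ₁, …, μ_ℓ ∈ (0,1)`, there is an open dense set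
`U ⊆ ℝ²` on which the `ℓ + 3` polynomials `P_{μᵢ}(z,v), P₀♯(z,v), P₁♯(z,v), P_{𝔫₃}(z,v)`
are pairwise coprime. -/
theorem stmt_18 (ℓ : ℕ) (μ : Fin ℓ → ℝ)
    (hμ : ∀ i, μ i ∈ Set.Ioo (0 : ℝ) 1) (hinj : Function.Injective μ) :
    ∃ U : Set (ℝ × ℝ), IsOpen U ∧ Dense U ∧
      ∀ p ∈ U, ∀ i j : Fin ℓ ⊕ Fin 3, i ≠ j →
        IsCoprime
          (Sum.elim (fun k : Fin ℓ => Pmu (μ k) p.1 p.2)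
            ![P0sharp p.1 p.2, P1sharp p.1 p.2, Pn3 p.1 p.2] i)
          (Sum.elim (fun k : Fin ℓ => Pmu (μ k) p.1 p.2)
            ![P0sharp p.1 p.2, P1sharp p.1 p.2, Pn3 p.1 p.2] j) := by
  refine ⟨coprimeLocus μ, isOpen_coprimeLocus μ, dense_coprimeLocus fun i => (hμ i).2, ?_⟩
  rintro ⟨z, v⟩ ⟨hz, hv, h03, hμ3⟩
  have hμ0 (k : Fin ℓ) := isCoprime_Pmu_P0sharp (hμ k).1.ne' hz hv
  have hμ1 (k : Fin ℓ) := isCoprime_Pmu_P1sharp (hμ k).2.ne hz hv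
  have hμn (k : Fin ℓ) := isCoprime_Pmu_Pn3 (hμ k).2 hz hv (hμ3 k)
  have h01 := isCoprime_P0sharp_P1sharp hz hv
  have h0n := isCoprime_P0sharp_Pn3 hz h03
  have h1n := isCoprime_P1sharp_Pn3 (v := v) hz
  rintro (i | i) (j | j) hij
  · exact isCoprime_Pmu_Pmu (hinj.ne fun h => hij (congrArg _ h)) hz hv
  · fin_cases j
    exacts [hμ0 i, hμ1 i, hμn i]
  · fin_cases i
    exacts [(hμ0 j).symm, (hμ1 j).symm, (hμn j).symm]
  · fin_cases i <;> fin_cases j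
    exacts [absurd rfl hij, h01, h0n, h01.symm, absurd rfl hij, h1n, h0n.symm, h1n.symm,
      absurd rfl hij]
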